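/- arXiv:1902.06059 — 3 statements merged into one kernel-verified Lean document; each statement's English description precedes it below -/
import Mathlib

section
/- Let T, L > 0 and let ℓ : [0,T] → ℝ be continuously differentiable with 0 < ℓ(t) < L for all t ∈ [0,T]. Set D_T = {(t,x) ∈ ℝ² : 0 < t < T, 0 < x < ℓ(t)} and 𝒟 = (0,T) × (0,L). Let G : ℝ² → ℝ² be continuous on the closure of D_T, define F : ℝ² → ℝ² by F = G on D_T and F = 0 on ℝ² \ D_T, and suppose there exists a locally integrable function g : 𝒟 → ℝ such that for every smooth φ : ℝ² → ℝ with compact support contained in 𝒟 one has ∫_{𝒟} ( F₁ ∂ₜφ + F₂ ∂ₓφ ) dt dx = − ∫_{𝒟} g φ dt dx (i.e., the distributional divergence of F on 𝒟 is the function g). Then for every t ∈ (0,T), the normal flux of G across the moving boundary vanishes: −ℓ'(t) G₁(t, ℓ(t)) + G₂(t, ℓ(t)) = 0. -/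
open MeasureTheory Set

lemma nf_approx (T : ℝ) (hT : 0 < T) (ℓ ℓ' : ℝ → ℝ) (h : ∀ t, HasDerivAt ℓ (ℓ' t) t)
    (hc : Continuous ℓ') (ε : ℝ) (hε : 0 < ε) :
    ∃ m m' : ℝ → ℝ, ContDiff ℝ (⊤ : ℕ∞) m ∧ Continuous m' ∧ (∀ t, HasDerivAt m (m' t) t) ∧
      ∀ t ∈ Icc 0 T, |m t - ℓ t| ≤ ε ∧ |m' t - ℓ' t| ≤ ε := by
  obtain ⟨p, hp⟩ := exists_polynomial_near_of_continuousOn 0 T ℓ' hc.continuousOn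
    (ε / (T + 1)) (by positivity)
  have hd : ∀ t, HasDerivAt (fun t => ℓ 0 + ∫ s in (0:ℝ)..t, p.eval s) (p.eval t) t := by
    intro t
    exact (intervalIntegral.integral_hasDerivAt_right (p.continuous.intervalIntegrable _ _)
      (p.continuous.stronglyMeasurableAtFilter _ _) p.continuous.continuousAt).const_add _
  refine ⟨fun t => ℓ 0 + ∫ s in (0:ℝ)..t, p.eval s, fun t => p.eval t, ?_, p.continuous, hd, ?_⟩
  · rw [contDiff_infty_iff_deriv]
    refine ⟨fun t => (hd t).differentiableAt, ?_⟩
    rw [show deriv (fun t => ℓ 0 + ∫ s in (0:ℝ)..t, p.eval s) = fun t => p.eval t from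
      funext fun t => (hd t).deriv]
    simpa using p.contDiff_aeval (𝕜 := ℝ) (⊤ : ℕ∞)
  · intro t ht
    have h1 : ε / (T + 1) ≤ ε := div_le_self hε.le (by linarith)
    refine ⟨?_, (hp t ht).le.trans h1⟩
    have := Convex.norm_image_sub_le_of_norm_hasDerivWithin_le
      (f := fun t => (ℓ 0 + ∫ s in (0:ℝ)..t, p.eval s) - ℓ t) (s := Icc 0 T) (x := 0) (y := t)
      (C := ε / (T+1)) (fun x hx => ((hd x).sub (h x)).hasDerivWithinAt)
      (fun x hx => (hp x hx).le) (convex_Icc _ _) ⟨le_rfl, hT.le⟩ ht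
    simp only [intervalIntegral.integral_same, Real.norm_eq_abs] at this
    simp only [add_zero, sub_self, sub_zero] at this
    refine this.trans ?_
    rw [abs_of_nonneg ht.1, div_mul_eq_mul_div, div_le_iff₀ (by linarith)]
    nlinarith [ht.2]

lemma nf_graph (f : ℝ → ℝ) (hf : Continuous f) : ∀ᵐ q : ℝ × ℝ, q.2 ≠ f q.1 := by
  have : MeasurableSet {q : ℝ × ℝ | q.2 = f q.1} :=
    (isClosed_eq (by fun_prop) (by fun_prop)).measurableSet
  have h0 : (volume : Measure (ℝ × ℝ)) {q : ℝ × ℝ | q.2 = f q.1} = 0 := by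
    rw [Measure.volume_eq_prod, Measure.measure_prod_null this]
    filter_upwards with t
    simp [preimage]
  rw [ae_iff]
  simpa using h0

lemma nf_cov (f : ℝ × ℝ → ℝ) (m : ℝ → ℝ) (δ : ℝ) (hδ : 0 < δ) (hf : Integrable f)
    (hf2 : Integrable (fun q : ℝ × ℝ => δ * f (q.1, m q.1 + δ * q.2))) :
    ∫ p, f p = ∫ q : ℝ × ℝ, δ * f (q.1, m q.1 + δ * q.2) := by
  rw [Measure.volume_eq_prod] at *
  rw [integral_prod _ hf, integral_prod _ hf2]
  congr 1
  ext t
  simp only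
  rw [integral_const_mul, Measure.integral_comp_mul_left (fun z => f (t, m t + z)),
    integral_add_left_eq_self (fun z => f (t, z)), abs_of_pos (inv_pos.2 hδ), smul_eq_mul,
    mul_inv_cancel_left₀ hδ.ne']

lemma nf_int (H : ℝ × ℝ → ℝ) (K : Set (ℝ × ℝ)) (hK : IsCompact K) (C : ℝ) (hm : Measurable H)
    (hb : ∀ q, ‖H q‖ ≤ K.indicator (fun _ => C) q) : Integrable H := by
  refine Integrable.mono' (g := K.indicator (fun _ => C)) ?_ hm.aestronglyMeasurable
    (Filter.Eventually.of_forall hb)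
  rw [integrable_indicator_iff hK.measurableSet]
  exact integrableOn_const hK.measure_lt_top.ne

lemma nf_core
    (T L : ℝ) (hT : 0 < T)
    (ℓ ℓ' : ℝ → ℝ) (hℓderiv : ∀ t, HasDerivAt ℓ (ℓ' t) t) (hℓ'cont : Continuous ℓ')
    (hℓpos : ∀ t ∈ Icc 0 T, 0 < ℓ t) (hℓL : ∀ t ∈ Icc 0 T, ℓ t < L)
    (DT 𝒟 : Set (ℝ × ℝ))
    (hDT : DT = {p : ℝ × ℝ | 0 < p.1 ∧ p.1 < T ∧ 0 < p.2 ∧ p.2 < ℓ p.1})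
    (h𝒟 : 𝒟 = Ioo 0 T ×ˢ Ioo 0 L)
    (hcl : ∀ t ∈ Ioo 0 T, (t, ℓ t) ∈ closure DT)
    (G F : ℝ × ℝ → ℝ × ℝ)
    (hGcont : ContinuousOn G (closure DT))
    (hF : F = DT.indicator G)
    (g : ℝ × ℝ → ℝ) (hg : LocallyIntegrableOn g 𝒟)
    (hdiv : ∀ φ : ℝ × ℝ → ℝ, ContDiff ℝ (⊤ : ℕ∞) φ → HasCompactSupport φ →
      tsupport φ ⊆ 𝒟 →
      (∫ p in 𝒟, ((F p).1 * fderiv ℝ φ p (1, 0) + (F p).2 * fderiv ℝ φ p (0, 1)))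
        = - ∫ p in 𝒟, g p * φ p)
    (χ : ℝ → ℝ) (hχ : ContDiff ℝ (⊤ : ℕ∞) χ) (hχc : HasCompactSupport χ)
    (hχs : tsupport χ ⊆ Ioo 0 T) :
    ∫ t, χ t * (-ℓ' t * (G (t, ℓ t)).1 + (G (t, ℓ t)).2) = 0 := by
  have hℓc : Continuous ℓ := continuous_iff_continuousAt.2 fun t => (hℓderiv t).continuousAt
  have hDTo : IsOpen DT := by
    rw [hDT]
    exact (isOpen_lt continuous_const continuous_fst).inter
      ((isOpen_lt continuous_fst continuous_const).inter
      ((isOpen_lt continuous_const continuous_snd).inter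
        (isOpen_lt continuous_snd (hℓc.comp continuous_fst))))
  have hDTs : DT ⊆ Icc 0 T ×ˢ Icc 0 L := by
    rw [hDT]
    rintro ⟨t, x⟩ ⟨h1, h2, h3, h4⟩
    exact ⟨⟨h1.le, h2.le⟩, h3.le, (h4.trans (hℓL t ⟨h1.le, h2.le⟩)).le⟩
  -- F measurable, bounded
  have hFm : Measurable F := by
    classical
    rw [hF, ← piecewise_eq_indicator]
    exact ContinuousOn.measurable_piecewise (hGcont.mono subset_closure)
      continuousOn_const hDTo.measurableSet
  obtain ⟨CF, hCF⟩ : ∃ C, ∀ p, ‖F p‖ ≤ C := by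
    have hcomp : IsCompact (closure DT) :=
      (isCompact_Icc.prod isCompact_Icc).of_isClosed_subset isClosed_closure
        (closure_minimal hDTs (isClosed_Icc.prod isClosed_Icc))
    obtain ⟨C, hC⟩ := hcomp.exists_bound_of_continuousOn hGcont
    refine ⟨max C 0, fun p => ?_⟩
    rw [hF]
    by_cases hp : p ∈ DT
    · rw [indicator_of_mem hp]
      exact (hC p (subset_closure hp)).trans (le_max_left _ _)
    · rw [indicator_of_notMem hp]
      simp
  have hCF1 : ∀ p, |(F p).1| ≤ CF := fun p => (norm_fst_le (F p)).trans (hCF p)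
  have hCF2 : ∀ p, |(F p).2| ≤ CF := fun p => (norm_snd_le (F p)).trans (hCF p)
  have hCF0 : 0 ≤ CF := (norm_nonneg _).trans (hCF 0)
  -- gap
  obtain ⟨c, hc0, hc1, hc⟩ : ∃ c : ℝ, 0 < c ∧ c ≤ 1 ∧
      ∀ t ∈ Icc 0 T, 4 * c ≤ ℓ t ∧ ℓ t ≤ L - 4 * c := by
    have hne : (Icc 0 T).Nonempty := ⟨0, le_rfl, hT.le⟩
    obtain ⟨a, ha, ha'⟩ := isCompact_Icc.exists_isMinOn hne hℓc.continuousOn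
    obtain ⟨b, hb, hb'⟩ := isCompact_Icc.exists_isMaxOn hne hℓc.continuousOn
    have h1 := hℓpos a ha
    have h2 := hℓL b hb
    refine ⟨min 1 (min (ℓ a / 4) ((L - ℓ b) / 4)), ?_, min_le_left _ _, fun t ht => ?_⟩
    · refine lt_min one_pos (lt_min (by linarith) (by linarith))
    · have e1 : min 1 (min (ℓ a / 4) ((L - ℓ b) / 4)) ≤ ℓ a / 4 :=
        (min_le_right _ _).trans (min_le_left _ _)
      have e2 : min 1 (min (ℓ a / 4) ((L - ℓ b) / 4)) ≤ (L - ℓ b) / 4 :=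
        (min_le_right _ _).trans (min_le_right _ _)
      have e3 : ℓ a ≤ ℓ t := ha' ht
      have e4 : ℓ t ≤ ℓ b := hb' ht
      constructor <;> linarith
  -- eta
  obtain ⟨η, hηs, hηc, hη, hηr, hη0⟩ := exists_contDiff_tsupport_subset (n := ⊤)
    (Icc_mem_nhds (show (-1:ℝ) < 0 by norm_num) (show (0:ℝ) < 1 by norm_num))
  -- sequences
  let δ : ℕ → ℝ := fun n => c / (n + 1)
  have hδ0 : ∀ n, 0 < δ n := fun n => by positivity
  have hδc : ∀ n, δ n ≤ c := fun n =>
    div_le_self hc0.le (by have : (0:ℝ) ≤ n := n.cast_nonneg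
                           linarith)
  have hδ1 : ∀ n, δ n ≤ 1 := fun n => (hδc n).trans hc1
  have hδt : Filter.Tendsto δ Filter.atTop (nhds 0) := by
    have := (tendsto_one_div_add_atTop_nhds_zero_nat (𝕜 := ℝ)).const_mul c
    simpa [δ, div_eq_mul_inv] using this
  choose m m' hms hm'c hmd hmb using fun n => nf_approx T hT ℓ ℓ' hℓderiv hℓ'cont
    (δ n * δ n) (mul_pos (hδ0 n) (hδ0 n))
  clear_value δ
  have hmc : ∀ n, Continuous (m n) := fun n => (hms n).continuous
  have hδδ : ∀ n, δ n * δ n ≤ δ n := fun n => mul_le_of_le_one_left (hδ0 n).le (hδ1 n)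
  have hmt : ∀ t ∈ Icc 0 T, Filter.Tendsto (fun n => m n t) Filter.atTop (nhds (ℓ t)) := by
    intro t ht
    rw [tendsto_iff_norm_sub_tendsto_zero]
    exact squeeze_zero (fun n => norm_nonneg _)
      (fun n => ((hmb n t ht).1).trans (hδδ n)) hδt
  have hm't : ∀ t ∈ Icc 0 T, Filter.Tendsto (fun n => m' n t) Filter.atTop (nhds (ℓ' t)) := by
    intro t ht
    rw [tendsto_iff_norm_sub_tendsto_zero]
    exact squeeze_zero (fun n => norm_nonneg _)
      (fun n => ((hmb n t ht).2).trans (hδδ n)) hδt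
  obtain ⟨M, hM⟩ : ∃ M, ∀ n, ∀ t ∈ Icc 0 T, |m' n t| ≤ M := by
    obtain ⟨C, hC⟩ := (isCompact_Icc (a := (0:ℝ)) (b := T)).exists_bound_of_continuousOn
      hℓ'cont.continuousOn
    refine ⟨C + 1, fun n t ht => ?_⟩
    have h1 := (hmb n t ht).2.trans ((hδδ n).trans (hδ1 n))
    have h2 := hC t ht
    rw [Real.norm_eq_abs] at h2
    calc |m' n t| = |(m' n t - ℓ' t) + ℓ' t| := by ring_nf
      _ ≤ _ := abs_add_le _ _
      _ ≤ _ := by linarith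
  have hχd : Continuous (deriv χ) := hχ.continuous_deriv (by simp)
  have hηd : Continuous (deriv η) := hη.continuous_deriv (by simp)
  obtain ⟨A, hA⟩ := hχc.exists_bound_of_continuous hχ.continuous
  obtain ⟨A', hA'⟩ := hχc.deriv.exists_bound_of_continuous hχd
  obtain ⟨B, hB⟩ := hηc.exists_bound_of_continuous hη.continuous
  obtain ⟨B', hB'⟩ := hηc.deriv.exists_bound_of_continuous hηd
  simp only [Real.norm_eq_abs] at hA hA' hB hB'
  have hχ0 : ∀ t, t ∉ tsupport χ → χ t = 0 := fun t h => image_eq_zero_of_notMem_tsupport h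
  have hχ0' : ∀ t, t ∉ tsupport χ → deriv χ t = 0 := fun t h =>
    image_eq_zero_of_notMem_tsupport fun h' => h (tsupport_deriv_subset h')
  have hη0z : ∀ t, t ∉ tsupport η → η t = 0 := fun t h => image_eq_zero_of_notMem_tsupport h
  have hη0' : ∀ t, t ∉ tsupport η → deriv η t = 0 := fun t h =>
    image_eq_zero_of_notMem_tsupport fun h' => h (tsupport_deriv_subset h')
  -- test functions
  let ψ : ℕ → ℝ × ℝ → ℝ := fun n p => χ p.1 * η ((p.2 - m n p.1) / δ n)
  have hψs : ∀ n, ContDiff ℝ (⊤ : ℕ∞) (ψ n) := fun n =>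
    (hχ.comp contDiff_fst).mul (hη.comp ((contDiff_snd.sub ((hms n).comp contDiff_fst)).div_const _))
  let K : Set (ℝ × ℝ) := tsupport χ ×ˢ Icc (2 * c) (L - 2 * c)
  have hKc : IsCompact K := hχc.isCompact.prod isCompact_Icc
  have hKs : K ⊆ 𝒟 := by
    rw [h𝒟]
    rintro ⟨t, x⟩ ⟨h1, h2, h3⟩
    exact ⟨hχs h1, by simp only at h2; linarith, by simp only at h3; linarith⟩
  have hψ0 : ∀ n, ∀ p ∉ K, ψ n p = 0 := by
    intro n p hp
    by_cases h1 : p.1 ∈ tsupport χ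
    · by_cases h2 : (p.2 - m n p.1) / δ n ∈ tsupport η
      · exfalso
        apply hp
        have h3 := hηs h2
        rw [mem_Icc, le_div_iff₀ (hδ0 n), div_le_iff₀ (hδ0 n)] at h3
        have ht := Ioo_subset_Icc_self (hχs h1)
        have h4 := abs_le.1 ((hmb n p.1 ht).1.trans (hδδ n))
        have h5 := hc _ ht
        have h6 := hδc n
        exact ⟨h1, by linarith, by linarith⟩
      · simp only [ψ, hη0z _ h2, mul_zero]
    · simp only [ψ, hχ0 _ h1, zero_mul]
  have hψts : ∀ n, tsupport (ψ n) ⊆ K := fun n =>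
    closure_minimal (fun p hp => by_contra fun h => hp (hψ0 n p h)) hKc.isClosed
  have hψc : ∀ n, HasCompactSupport (ψ n) := fun n => HasCompactSupport.intro hKc (hψ0 n)
  have hψ1 : ∀ n p, fderiv ℝ (ψ n) p (1, 0) = deriv χ p.1 * η ((p.2 - m n p.1) / δ n) +
      χ p.1 * (deriv η ((p.2 - m n p.1) / δ n) * (-(m' n p.1) / δ n)) := by
    rintro n ⟨t, x⟩
    have h1 : HasDerivAt (fun s => ψ n (s, x)) (fderiv ℝ (ψ n) (t, x) (1, 0)) t :=
      HasFDerivAt.comp_hasDerivAt (f := fun s : ℝ => (s, x)) t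
        (((hψs n).differentiable (by simp)) (t, x)).hasFDerivAt
        ((hasDerivAt_id t).prodMk (hasDerivAt_const t x))
    have h2 : HasDerivAt (fun s => ψ n (s, x)) _ t :=
      ((hχ.differentiable (by simp)) t).hasDerivAt.mul
        (((hη.differentiable (by simp)) _).hasDerivAt.comp t
          (((hmd n t).const_sub x).div_const (δ n)))
    exact h1.unique h2
  have hψ2 : ∀ n p, fderiv ℝ (ψ n) p (0, 1) =
      χ p.1 * (deriv η ((p.2 - m n p.1) / δ n) * (1 / δ n)) := by
    rintro n ⟨t, x⟩
    have h1 : HasDerivAt (fun s => ψ n (t, s)) (fderiv ℝ (ψ n) (t, x) (0, 1)) x :=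
      (((hψs n).differentiable (by simp)) (t, x)).hasFDerivAt.comp_hasDerivAt x
        ((hasDerivAt_const x t).prodMk (hasDerivAt_id x))
    have h2 : HasDerivAt (fun s => ψ n (t, s)) _ x :=
      (((hη.differentiable (by simp)) _).hasDerivAt.comp x
          (((hasDerivAt_id x).sub_const (m n t)).div_const (δ n))).const_mul (χ t)
    exact h1.unique h2
  -- RHS tends to zero
  have hgK : IntegrableOn g K := hg.integrableOn_compact_subset hKs hKc
  have hR : Filter.Tendsto (fun n => ∫ p in 𝒟, g p * ψ n p) Filter.atTop (nhds 0) := by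
    have e : ∀ n, ∫ p in 𝒟, g p * ψ n p = ∫ p in K, g p * ψ n p := by
      intro n
      rw [setIntegral_eq_integral_of_forall_compl_eq_zero,
        setIntegral_eq_integral_of_forall_compl_eq_zero]
      · intro p hp
        rw [hψ0 n p hp, mul_zero]
      · intro p hp
        rw [hψ0 n p (fun h => hp (hKs h)), mul_zero]
    simp_rw [e]
    have := tendsto_integral_of_dominated_convergence (μ := volume.restrict K)
      (F := fun n p => g p * ψ n p) (f := fun _ => (0:ℝ)) (fun p => ‖g p‖ * (A * B))
      (fun n => hgK.aestronglyMeasurable.mul (hψs n).continuous.aestronglyMeasurable)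
      (hgK.norm.mul_const _) ?_ ?_
    · simpa using this
    · intro n
      filter_upwards with p
      rw [norm_mul]
      gcongr
      simp only [ψ, norm_mul, Real.norm_eq_abs]
      exact mul_le_mul (hA _) (hB _) (abs_nonneg _) ((abs_nonneg _).trans (hA 0))
    · filter_upwards [ae_restrict_of_ae (nf_graph ℓ hℓc), ae_restrict_mem hKc.measurableSet]
        with p hp hpK
      have ht := Ioo_subset_Icc_self (hχs hpK.1)
      have hpos : 0 < |p.2 - ℓ p.1| := abs_pos.2 (sub_ne_zero.2 hp)
      have ev : ∀ᶠ n in Filter.atTop, δ n < |p.2 - ℓ p.1| / 2 :=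
        hδt.eventually_lt_const (by linarith)
      refine tendsto_const_nhds.congr' ?_
      filter_upwards [ev] with n hn
      have : (p.2 - m n p.1) / δ n ∉ tsupport η := by
        intro h2
        have h3 := hηs h2
        rw [mem_Icc, le_div_iff₀ (hδ0 n), div_le_iff₀ (hδ0 n)] at h3
        have h4 := abs_le.1 ((hmb n p.1 ht).1.trans (hδδ n))
        have : |p.2 - ℓ p.1| ≤ 2 * δ n := abs_le.2 ⟨by linarith, by linarith⟩
        linarith
      simp only [ψ, hη0z _ this, mul_zero]
  -- LHS
  let f : ℕ → ℝ × ℝ → ℝ := fun n p =>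
    (F p).1 * fderiv ℝ (ψ n) p (1, 0) + (F p).2 * fderiv ℝ (ψ n) p (0, 1)
  have hF1m : Measurable fun p => (F p).1 := hFm.fst
  have hF2m : Measurable fun p => (F p).2 := hFm.snd
  have hfm : ∀ n, Measurable (f n) := by
    intro n
    have hcd : Continuous (fderiv ℝ (ψ n)) := (hψs n).continuous_fderiv (by simp)
    have h1 : Continuous fun p => fderiv ℝ (ψ n) p (1, 0) := hcd.clm_apply continuous_const
    have h2 : Continuous fun p => fderiv ℝ (ψ n) p (0, 1) := hcd.clm_apply continuous_const
    exact (hF1m.mul h1.measurable).add (hF2m.mul h2.measurable)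
  have hf0 : ∀ n, ∀ p ∉ K, f n p = 0 := by
    intro n p hp
    simp only [f, fderiv_of_notMem_tsupport ℝ (fun h => hp (hψts n h))]
    simp
  have hfi : ∀ n, Integrable (f n) := by
    intro n
    have hcd : Continuous (fderiv ℝ (ψ n)) := (hψs n).continuous_fderiv (by simp)
    obtain ⟨C1, hC1⟩ := hKc.exists_bound_of_continuousOn
      (f := fun p => fderiv ℝ (ψ n) p (1, 0)) (hcd.clm_apply continuous_const).continuousOn
    obtain ⟨C2, hC2⟩ := hKc.exists_bound_of_continuousOn
      (f := fun p => fderiv ℝ (ψ n) p (0, 1)) (hcd.clm_apply continuous_const).continuousOn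
    refine nf_int _ K hKc (CF * C1 + CF * C2) (hfm n) fun p => ?_
    by_cases hp : p ∈ K
    · rw [indicator_of_mem hp]
      refine (norm_add_le _ _).trans ?_
      rw [norm_mul, norm_mul]
      exact add_le_add (mul_le_mul (hCF1 p) (hC1 p hp) (norm_nonneg _) hCF0)
        (mul_le_mul (hCF2 p) (hC2 p hp) (norm_nonneg _) hCF0)
    · rw [indicator_of_notMem hp, hf0 n p hp, norm_zero]
  let H : ℕ → ℝ × ℝ → ℝ := fun n q => δ n * f n (q.1, m n q.1 + δ n * q.2)
  have hHm : ∀ n, Measurable (H n) := by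
    intro n
    have : Continuous fun q : ℝ × ℝ => (q.1, m n q.1 + δ n * q.2) := by
      have := hmc n
      fun_prop
    exact ((hfm n).comp this.measurable).const_mul _
  have hH : ∀ n q, H n q = (F (q.1, m n q.1 + δ n * q.2)).1 *
      (δ n * (deriv χ q.1 * η q.2) - χ q.1 * (deriv η q.2 * m' n q.1)) +
      (F (q.1, m n q.1 + δ n * q.2)).2 * (χ q.1 * deriv η q.2) := by
    intro n q
    have hz : (m n q.1 + δ n * q.2 - m n q.1) / δ n = q.2 := by
      rw [add_sub_cancel_left, mul_div_cancel_left₀ _ (hδ0 n).ne']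
    simp only [H, f, hψ1, hψ2, hz]
    have := (hδ0 n).ne'
    field_simp
    ring
  let K2 : Set (ℝ × ℝ) := tsupport χ ×ˢ tsupport η
  have hK2 : IsCompact K2 := hχc.isCompact.prod hηc.isCompact
  have hA0 : 0 ≤ A := (abs_nonneg _).trans (hA 0)
  have hA0' : 0 ≤ A' := (abs_nonneg _).trans (hA' 0)
  have hB0 : 0 ≤ B := (abs_nonneg _).trans (hB 0)
  have hB0' : 0 ≤ B' := (abs_nonneg _).trans (hB' 0)
  have hM0 : 0 ≤ M := (abs_nonneg _).trans (hM 0 0 ⟨le_rfl, hT.le⟩)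
  let C : ℝ := CF * (1 * (A' * B) + A * (B' * M)) + CF * (A * B')
  have hHb : ∀ n q, ‖H n q‖ ≤ K2.indicator (fun _ => C) q := by
    intro n q
    by_cases hq : q ∈ K2
    · rw [indicator_of_mem hq, hH]
      have ht := Ioo_subset_Icc_self (hχs hq.1)
      refine (norm_add_le _ _).trans ?_
      simp only [norm_mul, Real.norm_eq_abs]
      have h1 : |δ n * (deriv χ q.1 * η q.2) - χ q.1 * (deriv η q.2 * m' n q.1)| ≤
          1 * (A' * B) + A * (B' * M) := by
        refine (abs_sub _ _).trans ?_
        simp only [abs_mul]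
        have e1 : |δ n| ≤ 1 := by rw [abs_of_pos (hδ0 n)]; exact hδ1 n
        have e2 := hM n _ ht
        have := hA q.1
        have := hA' q.1
        have := hB q.2
        have := hB' q.2
        gcongr
      have := hA q.1
      have := hB' q.2
      have := hCF1 (q.1, m n q.1 + δ n * q.2)
      have := hCF2 (q.1, m n q.1 + δ n * q.2)
      simp only [C]
      gcongr
    · rw [indicator_of_notMem hq, hH]
      by_cases h1 : q.1 ∈ tsupport χ
      · have h2 : q.2 ∉ tsupport η := fun h => hq ⟨h1, h⟩
        simp [hη0z _ h2, hη0' _ h2]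
      · simp [hχ0 _ h1, hχ0' _ h1]
  have hHi : ∀ n, Integrable (H n) := fun n => nf_int _ K2 hK2 C (hHm n) (hHb n)
  have hLeq : ∀ n, ∫ q, H n q = - ∫ p in 𝒟, g p * ψ n p := by
    intro n
    rw [← hdiv (ψ n) (hψs n) (hψc n) ((hψts n).trans hKs),
      setIntegral_eq_integral_of_forall_compl_eq_zero
        (fun p hp => hf0 n p (fun h => hp (hKs h)))]
    exact (nf_cov (f n) (m n) (δ n) (hδ0 n) (hfi n) (hHi n)).symm
  have hlim : Filter.Tendsto (fun n => ∫ q, H n q) Filter.atTop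
      (nhds (∫ q : ℝ × ℝ, (χ q.1 * (-ℓ' q.1 * (G (q.1, ℓ q.1)).1 + (G (q.1, ℓ q.1)).2)) *
        (Iic (0:ℝ)).indicator (deriv η) q.2)) := by
    refine tendsto_integral_of_dominated_convergence (K2.indicator fun _ => C)
      (fun n => (hHm n).aestronglyMeasurable) ?_
      (fun n => Filter.Eventually.of_forall (hHb n)) ?_
    · rw [integrable_indicator_iff hK2.measurableSet]
      exact integrableOn_const hK2.measure_lt_top.ne
    filter_upwards [nf_graph (fun _ => 0) continuous_const] with q hq
    simp only [hH]
    by_cases h1 : q.1 ∈ tsupport χ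
    swap
    · simp [hχ0 _ h1, hχ0' _ h1]
    have ht' := hχs h1
    have ht := Ioo_subset_Icc_self ht'
    have hev : ∀ᶠ n in Filter.atTop, δ n < |q.2| := hδt.eventually_lt_const (abs_pos.2 hq)
    have key : ∀ V : ℝ × ℝ, Filter.Tendsto (fun n => F (q.1, m n q.1 + δ n * q.2))
        Filter.atTop (nhds V) → Filter.Tendsto (fun n => (F (q.1, m n q.1 + δ n * q.2)).1 *
      (δ n * (deriv χ q.1 * η q.2) - χ q.1 * (deriv η q.2 * m' n q.1)) +
      (F (q.1, m n q.1 + δ n * q.2)).2 * (χ q.1 * deriv η q.2)) Filter.atTop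
      (nhds (V.1 * (0 * (deriv χ q.1 * η q.2) - χ q.1 * (deriv η q.2 * ℓ' q.1)) +
        V.2 * (χ q.1 * deriv η q.2))) := by
      intro V hV
      have hV1 := (continuous_fst.tendsto V).comp hV
      have hV2 := (continuous_snd.tendsto V).comp hV
      exact (hV1.mul ((hδt.mul_const _).sub (((hm't _ ht).const_mul _).const_mul _))).add
        (hV2.mul_const _)
    have hpt : Filter.Tendsto (fun n => (q.1, m n q.1 + δ n * q.2)) Filter.atTop
        (nhds (q.1, ℓ q.1)) := by
      have := (hmt _ ht).add (hδt.mul_const q.2)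
      rw [zero_mul, add_zero] at this
      exact tendsto_const_nhds.prodMk_nhds this
    rcases lt_or_gt_of_ne hq with h | h
    · rw [indicator_of_mem (show q.2 ∈ Iic (0:ℝ) from h.le)]
      have hin : ∀ᶠ n in Filter.atTop, (q.1, m n q.1 + δ n * q.2) ∈ DT := by
        have hp : ∀ᶠ p in nhds (q.1, ℓ q.1), (0:ℝ) < p.2 :=
          continuous_snd.continuousAt.eventually_const_lt (hℓpos _ ht)
        filter_upwards [hev, hpt.eventually hp] with n hn hn2
        rw [hDT]
        refine ⟨ht'.1, ht'.2, hn2, ?_⟩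
        have h4 := abs_le.1 (hmb n q.1 ht).1
        rw [abs_of_neg h] at hn
        have := mul_lt_mul_of_pos_left hn (hδ0 n)
        simp only
        linarith
      have := key (G (q.1, ℓ q.1)) (by
        have h5 : Filter.Tendsto (fun n => G (q.1, m n q.1 + δ n * q.2)) Filter.atTop
            (nhds (G (q.1, ℓ q.1))) :=
          (hGcont _ (hcl _ ht')).tendsto.comp (tendsto_nhdsWithin_iff.2
            ⟨hpt, hin.mono fun n hn => subset_closure hn⟩)
        refine h5.congr' ?_
        filter_upwards [hin] with n hn
        rw [hF, indicator_of_mem hn])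
      convert this using 2
      ring
    · rw [indicator_of_notMem (show q.2 ∉ Iic (0:ℝ) from not_le.2 h)]
      have := key 0 (by
        refine tendsto_const_nhds.congr' ?_
        filter_upwards [hev] with n hn
        rw [hF, indicator_of_notMem]
        rw [hDT]
        rintro ⟨-, -, -, h6⟩
        have h4 := abs_le.1 (hmb n q.1 ht).1
        rw [abs_of_pos h] at hn
        have := mul_lt_mul_of_pos_left hn (hδ0 n)
        simp only at h6
        linarith)
      convert this using 2
      simp
  rw [Measure.volume_eq_prod, integral_prod_mul (fun t => χ t * (-ℓ' t * (G (t, ℓ t)).1 + (G (t, ℓ t)).2))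
    ((Iic (0:ℝ)).indicator (deriv η)), integral_indicator measurableSet_Iic,
    HasCompactSupport.integral_Iic_deriv_eq (hη.of_le (by exact_mod_cast le_top)) hηc, hη0, mul_one] at hlim
  rw [← Measure.volume_eq_prod] at hlim
  simp_rw [hLeq] at hlim
  have := tendsto_nhds_unique hlim hR.neg
  simpa using this


/-- If a vector field `F`, obtained by extending a field `G` (continuous on the closure of
the moving domain `D_T`) by zero outside `D_T`, has a distributional divergence on the
extended domain `𝒟` that is a locally integrable function, then the normal flux of `G`
across the moving boundary `B_T = {(t, ℓ(t))}` vanishes. -/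
theorem normal_flux_vanishes
    (T L : ℝ) (hT : 0 < T) (hL : 0 < L)
    (ℓ ℓ' : ℝ → ℝ) (hℓderiv : ∀ t, HasDerivAt ℓ (ℓ' t) t) (hℓ'cont : Continuous ℓ')
    (hℓpos : ∀ t ∈ Icc 0 T, 0 < ℓ t) (hℓL : ∀ t ∈ Icc 0 T, ℓ t < L)
    (DT 𝒟 : Set (ℝ × ℝ))
    (hDT : DT = {p : ℝ × ℝ | 0 < p.1 ∧ p.1 < T ∧ 0 < p.2 ∧ p.2 < ℓ p.1})
    (h𝒟 : 𝒟 = Ioo 0 T ×ˢ Ioo 0 L)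
    (G F : ℝ × ℝ → ℝ × ℝ)
    (hGcont : ContinuousOn G (closure DT))
    (hF : F = DT.indicator G)
    (g : ℝ × ℝ → ℝ) (hg : LocallyIntegrableOn g 𝒟)
    (hdiv : ∀ φ : ℝ × ℝ → ℝ, ContDiff ℝ (⊤ : ℕ∞) φ → HasCompactSupport φ →
      tsupport φ ⊆ 𝒟 →
      (∫ p in 𝒟, ((F p).1 * fderiv ℝ φ p (1, 0) + (F p).2 * fderiv ℝ φ p (0, 1)))
        = - ∫ p in 𝒟, g p * φ p) :
    ∀ t ∈ Ioo (0:ℝ) T, -ℓ' t * (G (t, ℓ t)).1 + (G (t, ℓ t)).2 = 0 := by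
  have hℓc : Continuous ℓ := continuous_iff_continuousAt.2 fun t => (hℓderiv t).continuousAt
  have hcl : ∀ t ∈ Ioo 0 T, (t, ℓ t) ∈ closure DT := by
    intro t ht
    have h0 := hℓpos t (Ioo_subset_Icc_self ht)
    have h1 : ℓ t ∈ closure (Ioo 0 (ℓ t)) := by
      rw [closure_Ioo h0.ne]
      exact ⟨h0.le, le_rfl⟩
    have h2 : MapsTo (fun x => (t, x)) (Ioo 0 (ℓ t)) DT := by
      intro x hx
      rw [hDT]
      exact ⟨ht.1, ht.2, hx.1, hx.2⟩
    exact h2.closure (by fun_prop) h1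
  have hN : ContinuousOn (fun t => -ℓ' t * (G (t, ℓ t)).1 + (G (t, ℓ t)).2) (Ioo 0 T) := by
    have h1 : ContinuousOn (fun t => G (t, ℓ t)) (Ioo 0 T) :=
      hGcont.comp (continuous_id.prodMk hℓc).continuousOn hcl
    exact (hℓ'cont.neg.continuousOn.mul h1.fst).add h1.snd
  have hae := isOpen_Ioo.ae_eq_zero_of_integral_contDiff_smul_eq_zero
    (hN.locallyIntegrableOn (μ := volume) measurableSet_Ioo) (fun χ h1 h2 h3 =>
      nf_core T L hT ℓ ℓ' hℓderiv hℓ'cont hℓpos hℓL DT 𝒟 hDT h𝒟 hcl G F hGcont hF g hg hdiv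
        χ h1 h2 h3)
  exact Measure.eqOn_open_of_ae_eq (g := fun _ => (0:ℝ))
    ((ae_restrict_iff' measurableSet_Ioo).2 hae) isOpen_Ioo hN continuousOn_const
end

section
/- Let T, L > 0 and let ℓ : [0,T] → ℝ be continuously differentiable with 0 < ℓ(t) < L for all t ∈ [0,T]. Set D_T = {(t,x) ∈ ℝ² : 0 < t < T, 0 < x < ℓ(t)} and 𝒟 = (0,T) × (0,L). Let α, u : ℝ² → ℝ be continuous on the closure of D_T, define F : ℝ² → ℝ² by F = (α, u α) on D_T and F = 0 on ℝ² \ D_T, and suppose there exists a locally integrable g : 𝒟 → ℝ such that ∫_{𝒟} ( F₁ ∂ₜφ + F₂ ∂ₓφ ) dt dx = − ∫_{𝒟} g φ dt dx for every smooth φ with compact support contained in 𝒟. If moreover α(t, ℓ(t)) > 0 for every t ∈ (0,T), then the moving boundary satisfies the kinematic condition ℓ'(t) = u(t, ℓ(t)) for every t ∈ (0,T). -/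
open MeasureTheory Set
open Filter Topology

lemma approx_aux (T : ℝ) (hT : 0 < T) (ℓ ℓ' : ℝ → ℝ) (hd : ∀ t, HasDerivAt ℓ (ℓ' t) t)
    (hc : Continuous ℓ') (ε : ℝ) (hε : 0 < ε) :
    ∃ m : ℝ → ℝ, ContDiff ℝ (⊤ : ℕ∞) m ∧ ∀ t ∈ Icc 0 T, |m t - ℓ t| ≤ ε ^ 2 ∧
      |deriv m t - ℓ' t| ≤ ε := by
  have hδ : 0 < min ε (ε ^ 2 / T) := lt_min hε (by positivity)
  obtain ⟨p, hp⟩ := exists_polynomial_near_of_continuousOn 0 T ℓ' hc.continuousOn _ hδ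
  have hmd : ∀ t, HasDerivAt (fun t => ℓ 0 + ∫ s in (0:ℝ)..t, p.eval s) (p.eval t) t := by
    intro t
    exact (intervalIntegral.integral_hasDerivAt_right (p.continuous.intervalIntegrable _ _)
      (p.continuous.stronglyMeasurableAtFilter _ _) p.continuous.continuousAt).const_add _
  have hderiv : deriv (fun t => ℓ 0 + ∫ s in (0:ℝ)..t, p.eval s) = fun t => p.eval t :=
    funext fun t => (hmd t).deriv
  refine ⟨fun t => ℓ 0 + ∫ s in (0:ℝ)..t, p.eval s, ?_, ?_⟩
  · rw [contDiff_infty_iff_deriv]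
    refine ⟨fun t => (hmd t).differentiableAt, ?_⟩
    rw [hderiv]
    simpa using p.contDiff_aeval (𝕜 := ℝ) (⊤ : ℕ∞)
  · intro t ht
    rw [hderiv]
    refine ⟨?_, (hp t ht).le.trans (min_le_left _ _)⟩
    have := (convex_Icc 0 T).norm_image_sub_le_of_norm_hasDerivWithin_le
      (f := fun t => (ℓ 0 + ∫ s in (0:ℝ)..t, p.eval s) - ℓ t) (f' := fun t => p.eval t - ℓ' t)
      (C := ε ^ 2 / T) (x := 0) (y := t)
      (fun x _ => ((hmd x).sub (hd x)).hasDerivWithinAt)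
      (fun x hx => (hp x hx).le.trans (min_le_right _ _)) ⟨le_rfl, hT.le⟩ ht
    simp only [intervalIntegral.integral_same, add_zero, sub_self, sub_zero, Real.norm_eq_abs] at this
    refine this.trans ?_
    rw [abs_of_nonneg ht.1]
    calc ε ^ 2 / T * t ≤ ε ^ 2 / T * T := by gcongr; exact ht.2
      _ = ε ^ 2 := by field_simp

lemma change_aux (G : ℝ × ℝ → ℝ) (hG : Integrable G) (m : ℝ → ℝ) (ε : ℝ) (hε : 0 < ε) :
    ∫ p, G p = ∫ t, ∫ s, ε * G (t, m t + ε * s) := by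
  rw [Measure.volume_eq_prod, integral_prod _ (by rwa [← Measure.volume_eq_prod])]
  congr 1; ext t
  rw [integral_const_mul, Measure.integral_comp_mul_left (fun y => G (t, m t + y)),
    integral_add_left_eq_self (fun y => G (t,y)), abs_of_pos (by positivity), smul_eq_mul]
  field_simp

lemma graph_null (ℓ : ℝ → ℝ) (h : Continuous ℓ) : ∀ᵐ p : ℝ × ℝ, p.2 ≠ ℓ p.1 := by
  rw [ae_iff, Measure.volume_eq_prod, Measure.measure_prod_null]
  · refine Eventually.of_forall fun t => ?_
    have : (Prod.mk t ⁻¹' {a : ℝ × ℝ | ¬a.2 ≠ ℓ a.1}) = {ℓ t} := by ext; simp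
    show volume (Prod.mk t ⁻¹' {a : ℝ × ℝ | ¬a.2 ≠ ℓ a.1}) = 0
    rw [this]; simp
  · have : {a : ℝ × ℝ | ¬a.2 ≠ ℓ a.1} = {a : ℝ × ℝ | a.2 = ℓ a.1} := by ext; simp
    rw [this]
    exact (isClosed_eq continuous_snd (h.comp continuous_fst)).measurableSet

lemma fderiv_aux (η ψ m : ℝ → ℝ) (hη : ContDiff ℝ (⊤ : ℕ∞) η) (hψ : ContDiff ℝ (⊤ : ℕ∞) ψ)
    (hm : ContDiff ℝ (⊤ : ℕ∞) m) (ε : ℝ) (p : ℝ × ℝ) :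
    fderiv ℝ (fun p : ℝ × ℝ => η p.1 * ψ ((p.2 - m p.1) / ε)) p (1, 0) =
      deriv η p.1 * ψ ((p.2 - m p.1) / ε)
        - η p.1 * deriv ψ ((p.2 - m p.1) / ε) * deriv m p.1 / ε ∧
    fderiv ℝ (fun p : ℝ × ℝ => η p.1 * ψ ((p.2 - m p.1) / ε)) p (0, 1) =
      η p.1 * deriv ψ ((p.2 - m p.1) / ε) / ε := by
  have e : ∀ f : ℝ → ℝ, ContDiff ℝ (⊤ : ℕ∞) f → ∀ x, HasDerivAt f (deriv f x) x :=
    fun f hf x => (hf.differentiable (by simp) x).hasDerivAt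
  have h1 := (e η hη p.1).comp_hasFDerivAt p (hasFDerivAt_fst (𝕜 := ℝ) (p := p))
  have h2 := (e m hm p.1).comp_hasFDerivAt p (hasFDerivAt_fst (𝕜 := ℝ) (p := p))
  have h3 := (((hasFDerivAt_snd (𝕜 := ℝ) (p := p)).sub h2).mul_const ε⁻¹)
  have h4 := (e ψ hψ ((p.2 - m p.1) / ε)).comp_hasFDerivAt p h3
  have h5 := h1.mul h4
  have h6 : HasFDerivAt (fun p : ℝ × ℝ => η p.1 * ψ ((p.2 - m p.1) / ε)) _ p := h5
  rw [h6.fderiv]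
  constructor <;> simp <;> ring_nf

lemma lim_in {DT : Set (ℝ × ℝ)} {f : ℝ × ℝ → ℝ} (hf : ContinuousOn f (closure DT)) {t y : ℝ}
    (hty : (t, y) ∈ closure DT) {x : ℕ → ℝ} (hx : Tendsto x atTop (𝓝 y))
    (hin : ∀ᶠ n in atTop, (t, x n) ∈ DT) :
    Tendsto (fun n => DT.indicator f (t, x n)) atTop (𝓝 (f (t, y))) := by
  have h1 : Tendsto (fun n => (t, x n)) atTop (𝓝[closure DT] (t, y)) := by
    refine tendsto_nhdsWithin_iff.2 ⟨?_, hin.mono fun n h => subset_closure h⟩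
    exact tendsto_const_nhds.prodMk_nhds hx
  refine ((hf _ hty).tendsto.comp h1).congr' ?_
  filter_upwards [hin] with n hn
  simp [indicator_of_mem hn]

lemma ind_meas {DT : Set (ℝ × ℝ)} {f : ℝ × ℝ → ℝ} (hf : ContinuousOn f (closure DT))
    (hm : MeasurableSet DT) : Measurable (DT.indicator f) := by
  classical
  rw [← piecewise_eq_indicator]
  exact (hf.mono subset_closure).measurable_piecewise continuousOn_const hm

lemma ind_bdd {DT : Set (ℝ × ℝ)} {f : ℝ × ℝ → ℝ} (hf : ContinuousOn f (closure DT))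
    (hm : IsCompact (closure DT)) : ∃ C, 0 ≤ C ∧ ∀ p, |DT.indicator f p| ≤ C := by
  obtain ⟨C, hC⟩ := hm.exists_bound_of_continuousOn hf
  refine ⟨max C 0, le_max_right _ _, fun p => ?_⟩
  by_cases hp : p ∈ DT
  · rw [indicator_of_mem hp]; exact (hC p (subset_closure hp)).trans (le_max_left _ _)
  · rw [indicator_of_notMem hp]; simp

/-- Recovery of the kinematic boundary condition `ℓ'(t) = u(t, ℓ(t))` for the moving
tumour boundary, from the fact that the space-time flux field `(α, u α)` extended by
zero outside the moving domain `D_T` has a locally integrable distributional divergence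
on the extended domain `𝒟`, together with the positivity of `α` at the boundary. -/
theorem kinematic_boundary_condition
    (T L : ℝ) (hT : 0 < T) (hL : 0 < L)
    (ℓ ℓ' : ℝ → ℝ) (hℓderiv : ∀ t, HasDerivAt ℓ (ℓ' t) t) (hℓ'cont : Continuous ℓ')
    (hℓpos : ∀ t ∈ Icc 0 T, 0 < ℓ t) (hℓL : ∀ t ∈ Icc 0 T, ℓ t < L)
    (DT 𝒟 : Set (ℝ × ℝ))
    (hDT : DT = {p : ℝ × ℝ | 0 < p.1 ∧ p.1 < T ∧ 0 < p.2 ∧ p.2 < ℓ p.1})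
    (h𝒟 : 𝒟 = Ioo 0 T ×ˢ Ioo 0 L)
    (α u : ℝ × ℝ → ℝ)
    (hαcont : ContinuousOn α (closure DT)) (hucont : ContinuousOn u (closure DT))
    (F : ℝ × ℝ → ℝ × ℝ)
    (hF : F = DT.indicator (fun p => (α p, u p * α p)))
    (g : ℝ × ℝ → ℝ) (hg : LocallyIntegrableOn g 𝒟)
    (hdiv : ∀ φ : ℝ × ℝ → ℝ, ContDiff ℝ (⊤ : ℕ∞) φ → HasCompactSupport φ →
      tsupport φ ⊆ 𝒟 →
      (∫ p in 𝒟, ((F p).1 * fderiv ℝ φ p (1, 0) + (F p).2 * fderiv ℝ φ p (0, 1)))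
        = - ∫ p in 𝒟, g p * φ p)
    (hαbdpos : ∀ t ∈ Ioo (0:ℝ) T, 0 < α (t, ℓ t)) :
    ∀ t ∈ Ioo (0:ℝ) T, ℓ' t = u (t, ℓ t) := by
  have hℓc : Continuous ℓ := continuous_iff_continuousAt.2 fun t => (hℓderiv t).continuousAt
  have hDTopen : IsOpen DT := by
    rw [hDT]
    exact (isOpen_lt continuous_const continuous_fst).inter
      ((isOpen_lt continuous_fst continuous_const).inter
      ((isOpen_lt continuous_const continuous_snd).inter
      (isOpen_lt continuous_snd (hℓc.comp continuous_fst))))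
  have hmemDT : ∀ t x, (t, x) ∈ DT ↔ 0 < t ∧ t < T ∧ 0 < x ∧ x < ℓ t := by
    intro t x; rw [hDT]; rfl
  have hDT𝒟 : DT ⊆ 𝒟 := by
    rintro ⟨t, x⟩ h
    obtain ⟨h1, h2, h3, h4⟩ := (hmemDT t x).1 h
    rw [h𝒟]
    exact ⟨⟨h1, h2⟩, h3, h4.trans (hℓL t ⟨h1.le, h2.le⟩)⟩
  have hcomp : IsCompact (closure DT) := by
    refine (isCompact_Icc.prod isCompact_Icc : IsCompact (Icc 0 T ×ˢ Icc 0 L)).closure_of_subset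
      (hDT𝒟.trans ?_)
    rw [h𝒟]
    exact prod_mono Ioo_subset_Icc_self Ioo_subset_Icc_self
  have hbd : ∀ t ∈ Ioo (0:ℝ) T, (t, ℓ t) ∈ closure DT := by
    intro t ht
    have hp := hℓpos t ⟨ht.1.le, ht.2.le⟩
    have : ℓ t ∈ closure (Ioo 0 (ℓ t)) := by
      rw [closure_Ioo hp.ne]; exact ⟨hp.le, le_rfl⟩
    exact map_mem_closure (f := fun x => (t, x)) (by fun_prop) this
      (fun x hx => (hmemDT t x).2 ⟨ht.1, ht.2, hx.1, hx.2⟩)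
  have hBcont : ContinuousOn (fun p => u p * α p) (closure DT) := hucont.mul hαcont
  set A := DT.indicator α with hA
  set B := DT.indicator (fun p => u p * α p) with hB
  have hF1 : ∀ p, (F p).1 = A p := by
    intro p; rw [hF, hA]; by_cases h : p ∈ DT <;> simp [h]
  have hF2 : ∀ p, (F p).2 = B p := by
    intro p; rw [hF, hB]; by_cases h : p ∈ DT <;> simp [h]
  have hAm : Measurable A := ind_meas hαcont hDTopen.measurableSet
  have hBm : Measurable B := ind_meas hBcont hDTopen.measurableSet
  obtain ⟨CA, hCA0, hCA⟩ := ind_bdd hαcont hcomp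
  obtain ⟨CB, hCB0, hCB⟩ := ind_bdd hBcont hcomp
  obtain ⟨M, hM⟩ := (isCompact_Icc (a := (0:ℝ)) (b := T)).exists_bound_of_continuousOn
    hℓ'cont.continuousOn
  have hM0 : 0 ≤ M := (norm_nonneg _).trans (hM 0 ⟨le_rfl, hT.le⟩)
  -- the margin
  obtain ⟨d, hd0, hd⟩ : ∃ d > 0, ∀ t ∈ Icc 0 T, d ≤ ℓ t ∧ ℓ t ≤ L - d := by
    obtain ⟨t1, ht1, h1⟩ := (isCompact_Icc (a := (0:ℝ)) (b := T)).exists_isMinOn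
      ⟨0, le_rfl, hT.le⟩ hℓc.continuousOn
    obtain ⟨t2, ht2, h2⟩ := (isCompact_Icc (a := (0:ℝ)) (b := T)).exists_isMaxOn
      ⟨0, le_rfl, hT.le⟩ hℓc.continuousOn
    refine ⟨min (ℓ t1) (L - ℓ t2), lt_min (hℓpos _ ht1) (sub_pos.2 (hℓL _ ht2)), fun t ht => ?_⟩
    have e1 : ℓ t1 ≤ ℓ t := h1 ht
    have e2 : ℓ t ≤ ℓ t2 := h2 ht
    have := min_le_left (ℓ t1) (L - ℓ t2)
    have := min_le_right (ℓ t1) (L - ℓ t2)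
    constructor <;> linarith
  set w : ℝ → ℝ := fun t => u (t, ℓ t) * α (t, ℓ t) - α (t, ℓ t) * ℓ' t with hw
  have hcurve : ContinuousOn (fun t => (t, ℓ t)) (Ioo 0 T) := by fun_prop
  have hwcont : ContinuousOn w (Ioo 0 T) :=
    (hBcont.comp hcurve hbd).sub ((hαcont.comp hcurve hbd).mul hℓ'cont.continuousOn)
  suffices key : ∀ η : ℝ → ℝ, ContDiff ℝ (⊤ : ℕ∞) η → HasCompactSupport η →
      tsupport η ⊆ Ioo 0 T → ∫ t, η t • w t = 0 by
    have h1 := isOpen_Ioo.ae_eq_zero_of_integral_contDiff_smul_eq_zero (μ := volume)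
      (hwcont.locallyIntegrableOn measurableSet_Ioo) key
    have h2 : EqOn w 0 (Ioo 0 T) := by
      refine Measure.eqOn_open_of_ae_eq (μ := volume) ?_ isOpen_Ioo hwcont continuousOn_const
      exact (ae_restrict_iff' measurableSet_Ioo).2 h1
    intro t ht
    have h3 : u (t, ℓ t) * α (t, ℓ t) - α (t, ℓ t) * ℓ' t = 0 := h2 ht
    have h4 := hαbdpos t ht
    have h5 : α (t, ℓ t) * (u (t, ℓ t) - ℓ' t) = 0 := by linarith
    rcases mul_eq_zero.1 h5 with h | h <;> linarith
  intro η hη hηc hηs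
  obtain ⟨Cη, hCη⟩ := hηc.exists_bound_of_continuous hη.continuous
  have hη0 : ∀ t, t ∉ Ioo 0 T → η t = 0 := fun t ht => image_eq_zero_of_notMem_tsupport
    (fun h => ht (hηs h))
  have hη'0 : ∀ t, t ∉ Ioo 0 T → deriv η t = 0 := fun t ht => by
    by_contra h
    exact ht (hηs (support_deriv_subset h))
  -- the profile
  obtain ⟨ψ, hψ, hψc, hψ0, hψ1, hψs⟩ : ∃ ψ : ℝ → ℝ, ContDiff ℝ (⊤ : ℕ∞) ψ ∧ HasCompactSupport ψ ∧
      ψ 0 = 1 ∧ (∀ s, |ψ s| ≤ 1) ∧ ∀ s, 1 ≤ |s| → ψ s = 0 := by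
    let b : ContDiffBump (0:ℝ) := ⟨1 / 2, 1, by norm_num, by norm_num⟩
    refine ⟨b, b.contDiff, b.hasCompactSupport, ?_, ?_, ?_⟩
    · exact b.one_of_mem_closedBall (by simp [b])
    · intro s; rw [abs_of_nonneg b.nonneg]; exact b.le_one
    · intro s hs; exact b.zero_of_le_dist (by simpa [b] using hs)
  -- the scales
  obtain ⟨ε, hε0, hεlim, hε1, hεd⟩ : ∃ ε : ℕ → ℝ, (∀ n, 0 < ε n) ∧ Tendsto ε atTop (𝓝 0) ∧
      (∀ n, ε n ≤ 1) ∧ ∀ n, 4 * ε n ≤ d := by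
    have he : 0 < min 1 (d / 4) := lt_min one_pos (by linarith)
    have hle : ∀ n : ℕ, min 1 (d / 4) * (1 / ((n:ℝ) + 1)) ≤ min 1 (d / 4) := fun n =>
      mul_le_of_le_one_right he.le (by
        rw [div_le_one (by positivity)]; have : (0:ℝ) ≤ n := n.cast_nonneg
        linarith)
    refine ⟨fun n => min 1 (d / 4) * (1 / ((n:ℝ) + 1)), fun n => by positivity, ?_, ?_, ?_⟩
    · simpa using tendsto_one_div_add_atTop_nhds_zero_nat.const_mul (min 1 (d / 4))
    · exact fun n => (hle n).trans (min_le_left _ _)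
    · intro n; have := (hle n).trans (min_le_right _ _); simp only; linarith
  choose m hm hml using fun n => approx_aux T hT ℓ ℓ' hℓderiv hℓ'cont (ε n) (hε0 n)
  have hmε : ∀ n, ∀ t ∈ Icc 0 T, |m n t - ℓ t| ≤ ε n := fun n t ht =>
    (hml n t ht).1.trans (by have := hε0 n; have := hε1 n; nlinarith)
  have hmlim : ∀ t ∈ Icc 0 T, Tendsto (fun n => m n t) atTop (𝓝 (ℓ t)) := by
    intro t ht
    rw [tendsto_iff_dist_tendsto_zero]
    exact squeeze_zero (fun _ => dist_nonneg) (fun n => hmε n t ht) hεlim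
  have hm'lim : ∀ t ∈ Icc 0 T, Tendsto (fun n => deriv (m n) t) atTop (𝓝 (ℓ' t)) := by
    intro t ht
    rw [tendsto_iff_dist_tendsto_zero]
    exact squeeze_zero (fun _ => dist_nonneg) (fun n => (hml n t ht).2) hεlim
  set φ : ℕ → ℝ × ℝ → ℝ := fun n p => η p.1 * ψ ((p.2 - m n p.1) / ε n) with hφ
  have hφsm : ∀ n, ContDiff ℝ (⊤ : ℕ∞) (φ n) := by
    intro n
    exact (hη.comp contDiff_fst).mul
      (hψ.comp ((contDiff_snd.sub ((hm n).comp contDiff_fst)).div_const _))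
  have hφz : ∀ n p, ε n ≤ |p.2 - m n p.1| → φ n p = 0 := by
    intro n p h
    have : ψ ((p.2 - m n p.1) / ε n) = 0 := by
      apply hψs
      rw [abs_div, abs_of_pos (hε0 n), le_div_iff₀ (hε0 n)]; linarith
    simp only [hφ, this, mul_zero]
  set K : Set (ℝ × ℝ) := tsupport η ×ˢ Icc (d / 4) (L - d / 4) with hK
  have hKc : IsCompact K := hηc.isCompact.prod isCompact_Icc
  have hK𝒟 : K ⊆ 𝒟 := by
    rw [h𝒟]
    exact prod_mono hηs (fun x hx => ⟨by linarith [hx.1], by linarith [hx.2]⟩)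
  have hφK : ∀ n p, p ∉ K → φ n p = 0 := by
    intro n p hp
    by_contra hne
    have h1 : η p.1 ≠ 0 := fun h => hne (by simp [hφ, h])
    have h2 : |p.2 - m n p.1| < ε n := by
      by_contra h; exact hne (hφz n p (not_lt.1 h))
    have h3 : p.1 ∈ tsupport η := subset_tsupport _ h1
    have h4 := Ioo_subset_Icc_self (hηs h3)
    have h5 := abs_le.1 (hmε n _ h4)
    have h6 := hd _ h4
    have h7 := abs_lt.1 h2
    have h8 := hεd n
    exact hp ⟨h3, by linarith [h5.1, h6.1, h7.1], by linarith [h5.2, h6.2, h7.2]⟩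
  have hφts : ∀ n, tsupport (φ n) ⊆ K := fun n =>
    closure_minimal (fun p hp => by by_contra h; exact hp (hφK n p h)) hKc.isClosed
  have hφcs : ∀ n, HasCompactSupport (φ n) := fun n =>
    hKc.of_isClosed_subset (isClosed_tsupport _) (hφts n)
  have hdivn := fun n => hdiv (φ n) (hφsm n) (hφcs n) ((hφts n).trans hK𝒟)
  -- right-hand side
  have h𝒟m : MeasurableSet 𝒟 := by rw [h𝒟]; exact measurableSet_Ioo.prod measurableSet_Ioo
  have hR : Tendsto (fun n => ∫ p in 𝒟, g p * φ n p) atTop (𝓝 0) := by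
    have h0 : (0:ℝ) = ∫ p in 𝒟, (0:ℝ) := by simp
    rw [h0]
    have hgm : AEStronglyMeasurable g (volume.restrict 𝒟) := hg.aestronglyMeasurable
    refine tendsto_integral_of_dominated_convergence (K.indicator fun p => Cη * ‖g p‖) ?_ ?_ ?_ ?_
    · exact fun n => hgm.mul (hφsm n).continuous.aestronglyMeasurable
    · have h1 : IntegrableOn g K := hg.integrableOn_compact_subset hK𝒟 hKc
      exact ((integrable_indicator_iff hKc.measurableSet).2 (h1.norm.const_mul Cη)).restrict
    · intro n
      refine Eventually.of_forall fun p => ?_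
      by_cases hp : p ∈ K
      · rw [indicator_of_mem hp, norm_mul, mul_comm]
        have h1 : ‖φ n p‖ ≤ Cη := by
          simp only [hφ, norm_mul]
          calc _ ≤ ‖η p.1‖ * 1 := by gcongr; exact hψ1 _
            _ ≤ Cη := by rw [mul_one]; exact hCη _
        gcongr
      · rw [indicator_of_notMem hp, hφK n p hp]; simp
    · filter_upwards [ae_restrict_of_ae (graph_null ℓ hℓc), ae_restrict_mem h𝒟m] with p hp hp𝒟
      rw [h𝒟] at hp𝒟
      have ht : p.1 ∈ Icc 0 T := Ioo_subset_Icc_self hp𝒟.1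
      refine tendsto_const_nhds.congr' ?_
      have h1 : 0 < |p.2 - ℓ p.1| / 2 := by
        have := abs_pos.2 (sub_ne_zero.2 hp); linarith
      filter_upwards [hεlim.eventually (gt_mem_nhds h1)] with n hn
      rw [hφz n p ?_, mul_zero]
      have h2 := abs_sub_le p.2 (m n p.1) (ℓ p.1)
      have h3 := hmε n _ ht
      linarith
  -- left-hand side
  set H : ℕ → ℝ × ℝ → ℝ := fun n q =>
    A (q.1, m n q.1 + ε n * q.2) *
      (ε n * deriv η q.1 * ψ q.2 - η q.1 * deriv ψ q.2 * deriv (m n) q.1) +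
    B (q.1, m n q.1 + ε n * q.2) * (η q.1 * deriv ψ q.2) with hH
  have hηd : Continuous (deriv η) := hη.continuous_deriv (by simp)
  have hψd : Continuous (deriv ψ) := hψ.continuous_deriv (by simp)
  set bound : ℝ × ℝ → ℝ := fun q =>
    (CA * (M + 2) + CB) * ((|deriv η q.1| + |η q.1|) * (|ψ q.2| + |deriv ψ q.2|)) with hbound
  have hbint : Integrable bound := by
    refine Integrable.const_mul ?_ _
    rw [Measure.volume_eq_prod]
    refine Integrable.mul_prod (f := fun t => |deriv η t| + |η t|)
      (g := fun s => |ψ s| + |deriv ψ s|) ?_ ?_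
    · exact (hηd.integrable_of_hasCompactSupport hηc.deriv).abs.add
        (hη.continuous.integrable_of_hasCompactSupport hηc).abs
    · exact (hψ.continuous.integrable_of_hasCompactSupport hψc).abs.add
        (hψd.integrable_of_hasCompactSupport hψc.deriv).abs
  have hHm : ∀ n, Measurable (H n) := by
    intro n
    have hmap : Measurable (fun q : ℝ × ℝ => (q.1, m n q.1 + ε n * q.2)) := by
      have := (hm n).continuous
      exact Continuous.measurable (by fun_prop)
    have hmd : Continuous (deriv (m n)) := (hm n).continuous_deriv (by simp)
    have hηcc := hη.continuous
    have hψcc := hψ.continuous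
    refine ((hAm.comp hmap).mul (Continuous.measurable ?_)).add
      ((hBm.comp hmap).mul (Continuous.measurable ?_)) <;> fun_prop
  have hHb : ∀ n q, ‖H n q‖ ≤ bound q := by
    intro n q
    by_cases ht : q.1 ∈ Ioo 0 T
    · have ht' := Ioo_subset_Icc_self ht
      have hm' : |deriv (m n) q.1| ≤ M + 1 := by
        have h1 := (hml n _ ht').2
        have h2 : |ℓ' q.1| ≤ M := hM _ ht'
        have h3 := abs_add_le (deriv (m n) q.1 - ℓ' q.1) (ℓ' q.1)
        rw [sub_add_cancel] at h3
        linarith [hε1 n]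
      have hεa : |ε n| ≤ 1 := by rw [abs_of_pos (hε0 n)]; exact hε1 n
      have e1 := abs_nonneg (deriv η q.1)
      have e2 := abs_nonneg (η q.1)
      have e3 := abs_nonneg (ψ q.2)
      have e4 := abs_nonneg (deriv ψ q.2)
      set S := (|deriv η q.1| + |η q.1|) * (|ψ q.2| + |deriv ψ q.2|) with hS
      have f1 : |deriv η q.1| * |ψ q.2| ≤ S := by
        rw [hS]; gcongr <;> linarith
      have f2 : |η q.1| * |deriv ψ q.2| ≤ S := by
        rw [hS]; gcongr <;> linarith
      have hS0 : 0 ≤ S := by positivity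
      have g1 : |ε n * deriv η q.1 * ψ q.2| ≤ S := by
        rw [abs_mul, abs_mul, mul_assoc]
        calc _ ≤ 1 * (|deriv η q.1| * |ψ q.2|) := by gcongr
          _ ≤ S := by linarith
      have g2 : |η q.1 * deriv ψ q.2 * deriv (m n) q.1| ≤ S * (M + 1) := by
        rw [abs_mul, abs_mul]; gcongr
      have g3 : |η q.1 * deriv ψ q.2| ≤ S := by rw [abs_mul]; exact f2
      have g4 := abs_sub (ε n * deriv η q.1 * ψ q.2) (η q.1 * deriv ψ q.2 * deriv (m n) q.1)
      simp only [hH, hbound, Real.norm_eq_abs]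
      refine (abs_add_le _ _).trans ?_
      rw [abs_mul, abs_mul (B _)]
      calc _ ≤ CA * (S * (M + 2)) + CB * S := by
            gcongr
            · exact hCA _
            · linarith
            · exact hCB _
        _ = _ := by ring
    · have : H n q = 0 := by simp [hH, hη0 _ ht, hη'0 _ ht]
      rw [this, norm_zero]
      simp only [hbound]; positivity
  have hHint : ∀ n, Integrable (H n) := fun n =>
    hbint.mono' (hHm n).aestronglyMeasurable (Eventually.of_forall (hHb n))
  have hL1 : ∀ n, (∫ p in 𝒟, ((F p).1 * fderiv ℝ (φ n) p (1, 0) +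
      (F p).2 * fderiv ℝ (φ n) p (0, 1))) = ∫ q, H n q := by
    intro n
    simp only [hF1, hF2]
    rw [setIntegral_eq_integral_of_forall_compl_eq_zero]
    · rw [change_aux _ _ (m n) (ε n) (hε0 n)]
      · rw [Measure.volume_eq_prod, integral_prod _ (by
          rw [← Measure.volume_eq_prod]; exact hHint n)]
        congr 1; ext t; congr 1; ext s
        have hfd := fderiv_aux η ψ (m n) hη hψ (hm n) (ε n) (t, m n t + ε n * s)
        have hs : (m n t + ε n * s - m n t) / ε n = s := by
          have := (hε0 n).ne'
          field_simp; ring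
        simp only [hs] at hfd
        simp only [hφ, hH]
        rw [hfd.1, hfd.2]
        have := (hε0 n).ne'
        field_simp
      · have hc : ∀ v, Integrable (fun p => fderiv ℝ (φ n) p v) := fun v =>
          (((hφsm n).continuous_fderiv (by simp)).clm_apply
            continuous_const).integrable_of_hasCompactSupport ((hφcs n).fderiv_apply ℝ v)
        exact ((hc _).bdd_mul hAm.aestronglyMeasurable (Eventually.of_forall hCA)).add
          ((hc _).bdd_mul hBm.aestronglyMeasurable (Eventually.of_forall hCB))
    · intro p hp
      have hp' : p ∉ DT := fun h => hp (hDT𝒟 h)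
      simp [hA, hB, hp']
  have hL2 : Tendsto (fun n => ∫ q, H n q) atTop
      (𝓝 (∫ q : ℝ × ℝ, (η q.1 * w q.1) * (Iic (0:ℝ)).indicator (deriv ψ) q.2)) := by
    refine tendsto_integral_of_dominated_convergence bound
      (fun n => (hHm n).aestronglyMeasurable) hbint
      (fun n => Eventually.of_forall (hHb n)) ?_
    filter_upwards [graph_null (fun _ => 0) continuous_const] with q hq
    by_cases ht : q.1 ∈ Ioo 0 T
    swap
    · simp [hH, hη0 _ ht, hη'0 _ ht]
    have ht' := Ioo_subset_Icc_self ht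
    obtain ⟨t, s⟩ := q
    simp only at hq ht ht'
    have hx : Tendsto (fun n => m n t + ε n * s) atTop (𝓝 (ℓ t)) := by
      simpa using (hmlim t ht').add (hεlim.mul_const s)
    have hc1 : Tendsto (fun n => ε n * deriv η t * ψ s - η t * deriv ψ s * deriv (m n) t) atTop
        (𝓝 (0 * deriv η t * ψ s - η t * deriv ψ s * ℓ' t)) :=
      ((hεlim.mul_const _).mul_const _).sub ((hm'lim t ht').const_mul _)
    have hsmall : ∀ᶠ n in atTop, ε n < |s| := hεlim.eventually (gt_mem_nhds (abs_pos.2 hq))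
    rcases lt_or_gt_of_ne hq with hs | hs
    · have hin : ∀ᶠ n in atTop, (t, m n t + ε n * s) ∈ DT := by
        filter_upwards [hsmall, hx.eventually (lt_mem_nhds (hℓpos t ht'))] with n h1 h2
        refine (hmemDT _ _).2 ⟨ht.1, ht.2, h2, ?_⟩
        have h3 := (abs_le.1 (hml n t ht').1).2
        rw [abs_of_neg hs] at h1
        have h4 := hε0 n
        nlinarith
      have := ((lim_in hαcont (hbd t ht) hx hin).mul hc1).add
        ((lim_in hBcont (hbd t ht) hx hin).mul_const (η t * deriv ψ s))
      convert this using 2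
      rw [indicator_of_mem (show s ∈ Iic (0:ℝ) from hs.le)]
      simp only [hw]; ring
    · have hout : ∀ᶠ n in atTop, (t, m n t + ε n * s) ∉ DT := by
        filter_upwards [hsmall] with n h1 h2
        have h5 := ((hmemDT _ _).1 h2).2.2.2
        have h3 := (abs_le.1 (hml n t ht').1).1
        rw [abs_of_pos hs] at h1
        have h4 := hε0 n
        nlinarith
      rw [indicator_of_notMem (show s ∉ Iic (0:ℝ) from not_le.2 hs), mul_zero]
      refine tendsto_const_nhds.congr' ?_
      filter_upwards [hout] with n hn
      simp [hH, hA, hB, hn]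
  have hlim : (∫ q : ℝ × ℝ, (η q.1 * w q.1) * (Iic (0:ℝ)).indicator (deriv ψ) q.2) = 0 := by
    refine tendsto_nhds_unique hL2 ?_
    have h1 : ∀ n, ∫ q, H n q = - ∫ p in 𝒟, g p * φ n p := fun n => by rw [← hL1, hdivn]
    simp only [h1]
    simpa using hR.neg
  rw [Measure.volume_eq_prod, integral_prod_mul (fun t => η t * w t)
    ((Iic (0:ℝ)).indicator (deriv ψ)), integral_indicator measurableSet_Iic,
    hψc.integral_Iic_deriv_eq (hψ.of_le (by simp)), hψ0, mul_one] at hlim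
  simpa using hlim
end

section
/- Let c₁, c₂ ∈ ℝ with c₁ ≠ c₂, and let α₀ : ℝ → ℝ be differentiable. Define α : ℝ² → ℝ by α(t,x) = (c₂ − c₁) α₀(x − t) e^{(c₁ − c₂)t} / ( c₁ α₀(x − t) (1 − e^{(c₁ − c₂)t}) + c₂ − c₁ ). Then α(0,x) = α₀(x) for every x ∈ ℝ, and at every point (t,x) where the denominator c₁ α₀(x − t)(1 − e^{(c₁ − c₂)t}) + c₂ − c₁ is nonzero, α is differentiable and satisfies the semilinear advection equation ∂ₜα(t,x) + ∂ₓα(t,x) = α(t,x) ( c₁ (1 − α(t,x)) − c₂ ). -/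
open Real

/-- The closed-form solution along characteristics of the semilinear advection
equation `∂ₜα + ∂ₓα = α(c₁(1 − α) − c₂)`: it attains the initial profile `α₀` at
`t = 0`, and it is differentiable and satisfies the PDE wherever its denominator
is nonzero. -/
theorem characteristics_solution_semilinear_advection
    (c₁ c₂ : ℝ) (hc : c₁ ≠ c₂)
    (α₀ : ℝ → ℝ) (hα₀ : Differentiable ℝ α₀)
    (α : ℝ × ℝ → ℝ)
    (hα : ∀ t x : ℝ, α (t, x) =
      (c₂ - c₁) * α₀ (x - t) * Real.exp ((c₁ - c₂) * t) /
        (c₁ * α₀ (x - t) * (1 - Real.exp ((c₁ - c₂) * t)) + c₂ - c₁)) :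
    (∀ x : ℝ, α (0, x) = α₀ x) ∧
    (∀ t x : ℝ,
      c₁ * α₀ (x - t) * (1 - Real.exp ((c₁ - c₂) * t)) + c₂ - c₁ ≠ 0 →
      DifferentiableAt ℝ α (t, x) ∧
      fderiv ℝ α (t, x) (1, 0) + fderiv ℝ α (t, x) (0, 1)
        = α (t, x) * (c₁ * (1 - α (t, x)) - c₂)) := by
  have hk : c₂ - c₁ ≠ 0 := sub_ne_zero.mpr hc.symm
  refine ⟨fun x => ?_, fun t x hD => ?_⟩
  · rw [hα]
    simp only [sub_zero, mul_zero, Real.exp_zero, sub_self, mul_one, zero_add]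
    field_simp
  have hfun : α = fun p : ℝ × ℝ =>
      (c₂ - c₁) * α₀ (p.2 - p.1) * Real.exp ((c₁ - c₂) * p.1) /
        (c₁ * α₀ (p.2 - p.1) * (1 - Real.exp ((c₁ - c₂) * p.1)) + c₂ - c₁) := by
    funext p
    exact hα p.1 p.2
  have hdiff : DifferentiableAt ℝ α (t, x) := by
    rw [hfun]
    have h0 : DifferentiableAt ℝ (fun p : ℝ × ℝ => α₀ (p.2 - p.1)) (t, x) :=
      (hα₀ (x - t)).comp (t, x)
        (f := fun p : ℝ × ℝ => p.2 - p.1) (by fun_prop)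
    have hN : DifferentiableAt ℝ (fun p : ℝ × ℝ =>
        (c₂ - c₁) * α₀ (p.2 - p.1) * Real.exp ((c₁ - c₂) * p.1)) (t, x) :=
      (h0.const_mul _).fun_mul (by fun_prop)
    have hM : DifferentiableAt ℝ (fun p : ℝ × ℝ =>
        c₁ * α₀ (p.2 - p.1) * (1 - Real.exp ((c₁ - c₂) * p.1)) + c₂ - c₁) (t, x) :=
      (((h0.const_mul c₁).fun_mul (by fun_prop)).add_const c₂).sub_const c₁
    simp only [div_eq_mul_inv]
    exact hN.fun_mul (hM.fun_inv hD)
  refine ⟨hdiff, ?_⟩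
  have hsum : fderiv ℝ α (t, x) (1, 0) + fderiv ℝ α (t, x) (0, 1)
      = fderiv ℝ α (t, x) (1, 1) := by
    rw [← map_add]
    simp
  have hγ : HasDerivAt (fun s : ℝ => (s, s + (x - t))) ((1 : ℝ), (1 : ℝ)) t :=
    (hasDerivAt_id t).prodMk ((hasDerivAt_id t).add_const (x - t))
  have hpt : (t, t + (x - t)) = (t, x) := by simp
  have h1 : HasDerivAt (fun s : ℝ => α (s, s + (x - t))) (fderiv ℝ α (t, x) (1, 1)) t := by
    have hf : HasFDerivAt α (fderiv ℝ α (t, x)) (t, t + (x - t)) := by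
      rw [hpt]
      exact hdiff.hasFDerivAt
    exact hf.comp_hasDerivAt t hγ
  have hE : HasDerivAt (fun s : ℝ => Real.exp ((c₁ - c₂) * s))
      (Real.exp ((c₁ - c₂) * t) * ((c₁ - c₂) * 1)) t :=
    ((hasDerivAt_id t).const_mul (c₁ - c₂)).exp
  have h2 := (hE.const_mul ((c₂ - c₁) * α₀ (x - t))).fun_div
    ((((hE.const_sub 1).const_mul (c₁ * α₀ (x - t))).add_const c₂).sub_const c₁) hD
  have h3 : (fun s : ℝ => α (s, s + (x - t))) = fun s =>
      (c₂ - c₁) * α₀ (x - t) * Real.exp ((c₁ - c₂) * s) /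
        (c₁ * α₀ (x - t) * (1 - Real.exp ((c₁ - c₂) * s)) + c₂ - c₁) := by
    funext s
    rw [hα, show s + (x - t) - s = x - t by ring]
  rw [h3] at h1
  rw [hsum, h1.unique h2, hα]
  generalize Real.exp ((c₁ - c₂) * t) = E at *
  generalize α₀ (x - t) = B at *
  field_simp
  ring
end
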